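/- Let ℘̃ = ℘̃_{ω₁,ω₂} and ω₀ = (ω₁+ω₂)/2. Then the function z ↦ ℘̃(z)·℘̃(z−ω₀) extends to a constant function on ℂ, with constant value C(ω₁,ω₂) = ℘̃((ω₁+ω₂)/4)², and moreover C(ω₁,ω₂) = b(ω₁,ω₂)/4 where b is the coefficient in the differential equation (℘̃')² = 4℘̃³ + a℘̃² + b℘̃. -/

import Mathlib

open Asymptotics
open scoped Topology

/-- The Weierstrass ℘-function of the lattice `ω₁ℤ + ω₂ℤ`. -/
noncomputable def wp (ω₁ ω₂ : ℂ) (z : ℂ) : ℂ :=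
  1 / z ^ 2 + ∑' p : ℤ × ℤ,
    if p = 0 then 0 else
      (1 / (z + (p.1 : ℂ) * ω₁ + (p.2 : ℂ) * ω₂) ^ 2
        - 1 / ((p.1 : ℂ) * ω₁ + (p.2 : ℂ) * ω₂) ^ 2)

/-- The translated Weierstrass function `℘̃(z) = ℘(z + ω₀) − ℘(ω₀)`, `ω₀ = (ω₁+ω₂)/2`. -/
noncomputable def wpTilde (ω₁ ω₂ : ℂ) (z : ℂ) : ℂ :=
  wp ω₁ ω₂ (z + (ω₁ + ω₂) / 2) - wp ω₁ ω₂ ((ω₁ + ω₂) / 2)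

open Filter
open scoped PeriodPair

namespace PeriodPair

variable (L : PeriodPair)

lemma meromorphicOrderAt_derivWeierstrassP_ne_top (z : ℂ) :
    meromorphicOrderAt ℘'[L] z ≠ ⊤ := by
  refine L.meromorphic_derivWeierstrassP.exists_meromorphicOrderAt_ne_top_iff_forall.1
    ⟨0, fun htop ↦ ?_⟩ z
  have hlim : Tendsto (fun z : ℂ ↦ z ^ 3 * ℘'[L - (0 : ℂ)] z - 2) (𝓝[≠] 0) (𝓝 (-2)) := by
    have hcont : ContinuousAt (fun z : ℂ ↦ z ^ 3 * ℘'[L - (0 : ℂ)] z - 2) 0 := by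
      have := (L.analyticAt_derivWeierstrassPExcept 0).continuousAt
      fun_prop
    simpa using hcont.tendsto.mono_left nhdsWithin_le_nhds
  have hzero : (fun z : ℂ ↦ z ^ 3 * ℘'[L - (0 : ℂ)] z - 2) =ᶠ[𝓝[≠] 0] fun _ ↦ 0 := by
    filter_upwards [meromorphicOrderAt_eq_top_iff.1 htop, self_mem_nhdsWithin] with z hz hz0
    have hz0 : z ≠ 0 := hz0
    have := L.derivWeierstrassPExcept_def 0 z
    simp only [ZeroMemClass.coe_zero, sub_zero, hz, zero_add] at this
    rw [this]
    field_simp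
    ring
  simpa using tendsto_nhds_unique (hlim.congr' hzero) tendsto_const_nhds

/-- The second derivative of `℘` is `6 ℘² - g₂ / 2`. -/
lemma deriv_derivWeierstrassP {z : ℂ} (hz : z ∉ L.lattice) :
    deriv ℘'[L] z = 6 * ℘[L] z ^ 2 - L.g₂ / 2 := by
  have hcompl : ∀ᶠ x in 𝓝 z, x ∉ L.lattice := L.isClosed_lattice.isOpen_compl.mem_nhds hz
  have hP : AnalyticAt ℂ ℘[L] z := L.analyticOnNhd_weierstrassP _ hz
  have hP' : AnalyticAt ℂ ℘'[L] z := L.analyticOnNhd_derivWeierstrassP _ hz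
  have hne : ∀ᶠ x in 𝓝[≠] z, ℘'[L] x ≠ 0 :=
    (meromorphicOrderAt_ne_top_iff_eventually_ne_zero hP'.meromorphicAt).1
      (L.meromorphicOrderAt_derivWeierstrassP_ne_top z)
  have heq : deriv ℘'[L] =ᶠ[𝓝[≠] z] fun x ↦ 6 * ℘[L] x ^ 2 - L.g₂ / 2 := by
    filter_upwards [hne, hcompl.eventually_nhds.filter_mono nhdsWithin_le_nhds] with x hx hcx
    have hxL := hcx.self_of_nhds
    have hd : HasDerivAt ℘[L] (℘'[L] x) x := by
      simpa using (L.analyticOnNhd_weierstrassP _ hxL).differentiableAt.hasDerivAt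
    have hd' : HasDerivAt ℘'[L] (deriv ℘'[L] x) x :=
      (L.analyticOnNhd_derivWeierstrassP _ hxL).differentiableAt.hasDerivAt
    have hode : (fun y ↦ ℘'[L] y ^ 2) =ᶠ[𝓝 x]
        fun y ↦ 4 * ℘[L] y ^ 3 - L.g₂ * ℘[L] y - L.g₃ := by
      filter_upwards [hcx] with y hy using L.derivWeierstrassP_sq y hy
    have hboth := (hd'.pow 2).unique
      (((((hd.pow 3).const_mul 4).sub (hd.const_mul L.g₂)).sub_const L.g₃).congr_of_eventuallyEq
        hode)
    apply mul_left_cancel₀ hx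
    push_cast at hboth
    linear_combination hboth / 2
  have hleft : Tendsto (deriv ℘'[L]) (𝓝[≠] z) (𝓝 (deriv ℘'[L] z)) :=
    hP'.deriv.continuousAt.tendsto.mono_left nhdsWithin_le_nhds
  have hright : ContinuousAt (fun x ↦ 6 * ℘[L] x ^ 2 - L.g₂ / 2) z := by
    have := hP.continuousAt
    fun_prop
  exact tendsto_nhds_unique (hleft.congr' heq) (hright.tendsto.mono_left nhdsWithin_le_nhds)

lemma derivWeierstrassP_of_add_self_mem {w : ℂ} (hw : w + w ∈ L.lattice) : ℘'[L] w = 0 := by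
  have := L.derivWeierstrassP_add_coe (-w) ⟨w + w, hw⟩
  rw [← CharZero.eq_neg_self_iff]
  simpa using this

/-- Near a half period `w`, the function `℘ - ℘(w)` has a zero of order at least two. -/
lemma exists_weierstrassP_sub_eq_sq_mul {w : ℂ} (hw : w ∉ L.lattice) (hw2 : w + w ∈ L.lattice) :
    ∃ h : ℂ → ℂ, AnalyticAt ℂ h w ∧ h w = 3 * ℘[L] w ^ 2 - L.g₂ / 4 ∧
      ∀ᶠ z in 𝓝 w, ℘[L] z - ℘[L] w = (z - w) ^ 2 * h z := by
  have hP : AnalyticAt ℂ ℘[L] w := L.analyticOnNhd_weierstrassP _ hw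
  have hf : AnalyticAt ℂ (fun z ↦ ℘[L] z - ℘[L] w) w := by fun_prop
  have hord : ((2 : ℕ) : ℕ∞) ≤ analyticOrderAt (fun z ↦ ℘[L] z - ℘[L] w) w := by
    rw [natCast_le_analyticOrderAt_iff_iteratedDeriv_eq_zero hf]
    intro i hi
    interval_cases i
    · simp
    · simp [iteratedDeriv_one, L.derivWeierstrassP_of_add_self_mem hw2]
  obtain ⟨h, hh, heq⟩ := (natCast_le_analyticOrderAt hf).1 hord
  simp only [smul_eq_mul] at heq
  refine ⟨h, hh, ?_, heq⟩
  have hderiv : ℘'[L] =ᶠ[𝓝 w] fun z ↦ 2 * (z - w) * h z + (z - w) ^ 2 * deriv h z := by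
    filter_upwards [heq.eventually_nhds, hh.eventually_analyticAt] with z hz hhz
    have hd : HasDerivAt (fun z ↦ (z - w) ^ 2 * h z)
        (2 * (z - w) * h z + (z - w) ^ 2 * deriv h z) z := by
      simpa using! (((hasDerivAt_id z).sub_const w).pow 2).mul hhz.differentiableAt.hasDerivAt
    have hz' : (fun z ↦ ℘[L] z - ℘[L] w) =ᶠ[𝓝 z] fun z ↦ (z - w) ^ 2 * h z := hz
    simpa using hz'.deriv_eq.trans hd.deriv
  have hd : HasDerivAt (fun z ↦ 2 * (z - w) * h z + (z - w) ^ 2 * deriv h z) (2 * h w) w := by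
    have hid := (hasDerivAt_id w).sub_const w
    simpa using! ((hid.const_mul 2).mul hh.differentiableAt.hasDerivAt).add
      ((hid.pow 2).mul hh.deriv.differentiableAt.hasDerivAt)
  have := hderiv.deriv_eq.trans hd.deriv
  rw [L.deriv_derivWeierstrassP hw] at this
  linear_combination -this / 2

lemma weierstrassP_eq_except_zero_add (z : ℂ) :
    ℘[L] z = ℘[L - (0 : ℂ)] z + 1 / z ^ 2 := by
  simpa using (L.weierstrassPExcept_add 0 z).symm

lemma tendsto_weierstrassP_sub_mul_weierstrassP_sub {w : ℂ} (hw : w ∉ L.lattice)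
    (hw2 : w + w ∈ L.lattice) :
    Tendsto (fun z ↦ (℘[L] (z + w) - ℘[L] w) * (℘[L] z - ℘[L] w)) (𝓝[≠] 0)
      (𝓝 (3 * ℘[L] w ^ 2 - L.g₂ / 4)) := by
  obtain ⟨h, hh, hhw, heq⟩ := L.exists_weierstrassP_sub_eq_sq_mul hw hw2
  have hadd : Tendsto (fun z : ℂ ↦ z + w) (𝓝 0) (𝓝 w) := by
    exact Continuous.tendsto' (by fun_prop) _ _ (zero_add w)
  have hlim : Tendsto (fun z ↦ h (z + w) * (z ^ 2 * (℘[L - (0 : ℂ)] z - ℘[L] w) + 1)) (𝓝 0)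
      (𝓝 (3 * ℘[L] w ^ 2 - L.g₂ / 4)) := by
    have hcont : ContinuousAt (fun z : ℂ ↦ z ^ 2 * (℘[L - (0 : ℂ)] z - ℘[L] w) + 1) 0 := by
      have := (L.analyticAt_weierstrassPExcept 0).continuousAt
      fun_prop
    simpa [← hhw] using (hh.continuousAt.tendsto.comp hadd).mul hcont.tendsto
  refine (hlim.mono_left nhdsWithin_le_nhds).congr' ?_
  filter_upwards [(hadd.eventually heq).filter_mono nhdsWithin_le_nhds,
    self_mem_nhdsWithin] with z hz hz0
  have hz0 : z ≠ 0 := hz0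
  rw [hz, L.weierstrassP_eq_except_zero_add z, add_sub_cancel_right]
  field_simp
  ring

open Classical in
/-- The product `(℘(z + w) - ℘(w)) (℘(z) - ℘(w))`, with its poles filled in by the value
it takes there by continuity when `w` is a half period. -/
noncomputable def halfPeriodProduct (w z : ℂ) : ℂ :=
  if z ∈ L.lattice ∨ z + w ∈ L.lattice then 3 * ℘[L] w ^ 2 - L.g₂ / 4
  else (℘[L] (z + w) - ℘[L] w) * (℘[L] z - ℘[L] w)

lemma halfPeriodProduct_add_coe (w z : ℂ) (l : L.lattice) :
    L.halfPeriodProduct w (z + l) = L.halfPeriodProduct w z := by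
  have hmem (x : ℂ) : x + l ∈ L.lattice ↔ x ∈ L.lattice :=
    L.lattice.toAddSubgroup.add_mem_cancel_right l.2
  simp only [halfPeriodProduct, add_right_comm z (l : ℂ) w, weierstrassP_add_coe]
  classical exact if_congr (or_congr (hmem z) (add_right_comm z (l : ℂ) w ▸ hmem (z + w))) rfl rfl

lemma halfPeriodProduct_add_half {w : ℂ} (hw2 : w + w ∈ L.lattice) (z : ℂ) :
    L.halfPeriodProduct w (z + w) = L.halfPeriodProduct w z := by
  have hmem : z + w + w ∈ L.lattice ↔ z ∈ L.lattice := by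
    rw [add_assoc]
    exact L.lattice.toAddSubgroup.add_mem_cancel_right hw2
  have hP : ℘[L] (z + w + w) = ℘[L] z := by
    rw [add_assoc]
    exact L.weierstrassP_add_coe z ⟨w + w, hw2⟩
  classical exact if_congr ((or_congr_right hmem).trans or_comm) rfl (by rw [hP, mul_comm])

lemma differentiableAt_halfPeriodProduct_of_notMem {w z : ℂ} (hz : z ∉ L.lattice)
    (hzw : z + w ∉ L.lattice) : DifferentiableAt ℂ (L.halfPeriodProduct w) z := by
  have hadd : ContinuousAt (fun x : ℂ ↦ x + w) z := by fun_prop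
  have heq : L.halfPeriodProduct w =ᶠ[𝓝 z]
      fun x ↦ (℘[L] (x + w) - ℘[L] w) * (℘[L] x - ℘[L] w) := by
    filter_upwards [L.isClosed_lattice.isOpen_compl.mem_nhds hz,
      hadd (L.isClosed_lattice.isOpen_compl.mem_nhds hzw)] with x hx hxw
    exact if_neg (not_or.2 ⟨hx, hxw⟩)
  refine DifferentiableAt.congr_of_eventuallyEq ?_ heq
  have h₁ : DifferentiableAt ℂ (fun x ↦ ℘[L] (x + w)) z :=
    (differentiableAt_comp_add_right w).2 (L.analyticOnNhd_weierstrassP _ hzw).differentiableAt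
  have h₂ : DifferentiableAt ℂ ℘[L] z := (L.analyticOnNhd_weierstrassP _ hz).differentiableAt
  fun_prop

lemma differentiableAt_halfPeriodProduct_zero {w : ℂ} (hw : w ∉ L.lattice)
    (hw2 : w + w ∈ L.lattice) : DifferentiableAt ℂ (L.halfPeriodProduct w) 0 := by
  have hadd : ContinuousAt (fun x : ℂ ↦ x + w) 0 := by fun_prop
  have hmem : ∀ᶠ x in 𝓝[≠] (0 : ℂ), x ∉ L.lattice ∧ x + w ∉ L.lattice := by
    filter_upwards [self_mem_nhdsWithin,
      mem_nhdsWithin_of_mem_nhds (L.compl_lattice_sdiff_singleton_mem_nhds 0),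
      mem_nhdsWithin_of_mem_nhds (hadd (L.isClosed_lattice.isOpen_compl.mem_nhds
        (by simpa using hw)))] with x hx hx' hxw
    exact ⟨fun h ↦ hx' ⟨h, hx⟩, hxw⟩
  refine (Complex.analyticAt_of_differentiable_on_punctured_nhds_of_continuousAt ?_
    ?_).differentiableAt
  · filter_upwards [hmem] with x hx
    exact L.differentiableAt_halfPeriodProduct_of_notMem hx.1 hx.2
  · rw [continuousAt_iff_punctured_nhds]
    have hval : L.halfPeriodProduct w 0 = 3 * ℘[L] w ^ 2 - L.g₂ / 4 :=
      if_pos (Or.inl L.lattice.zero_mem)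
    rw [hval]
    refine (L.tendsto_weierstrassP_sub_mul_weierstrassP_sub hw hw2).congr' ?_
    filter_upwards [hmem] with x hx
    exact (if_neg (not_or.2 hx)).symm

lemma differentiable_halfPeriodProduct {w : ℂ} (hw : w ∉ L.lattice) (hw2 : w + w ∈ L.lattice) :
    Differentiable ℂ (L.halfPeriodProduct w) := by
  have hcoe (z : ℂ) (hz : z ∈ L.lattice) : DifferentiableAt ℂ (L.halfPeriodProduct w) z := by
    have h := L.differentiableAt_halfPeriodProduct_zero hw hw2
    rw [← add_neg_cancel z] at h
    have h := (differentiableAt_comp_add_right (-z)).2 h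
    have hfun : (fun x ↦ L.halfPeriodProduct w (x + -z)) = L.halfPeriodProduct w :=
      funext fun x ↦ L.halfPeriodProduct_add_coe w x (-⟨z, hz⟩)
    rwa [hfun] at h
  intro z
  by_cases hz : z ∈ L.lattice
  · exact hcoe z hz
  by_cases hzw : z + w ∈ L.lattice
  · have h := (differentiableAt_comp_add_right w).2 (hcoe _ hzw)
    rwa [funext (L.halfPeriodProduct_add_half hw2)] at h
  · exact L.differentiableAt_halfPeriodProduct_of_notMem hz hzw

/-- For a half period `w`, the product of `℘ - ℘(w)` with its translate by `w` is constant. -/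
theorem weierstrassP_sub_mul_weierstrassP_sub {w z : ℂ} (hw : w ∉ L.lattice)
    (hw2 : w + w ∈ L.lattice) (hz : z ∉ L.lattice) (hzw : z + w ∉ L.lattice) :
    (℘[L] (z + w) - ℘[L] w) * (℘[L] z - ℘[L] w) = 3 * ℘[L] w ^ 2 - L.g₂ / 4 := by
  have hdiff := L.differentiable_halfPeriodProduct hw hw2
  have hconst := hdiff.apply_eq_apply_of_bounded
    (IsZLattice.isCompact_range_of_periodic L.lattice _ hdiff.continuous fun x l hl ↦
      L.halfPeriodProduct_add_coe w x ⟨l, hl⟩).isBounded z 0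
  simpa [halfPeriodProduct, hz, hzw] using hconst

lemma isBigO_weierstrassPExcept_zero_sub :
    (fun z ↦ ℘[L - (0 : ℂ)] z - L.g₂ / 20 * z ^ 2) =O[𝓝 0] fun z ↦ z ^ 3 := by
  have h := (L.hasFPowerSeriesAt_weierstrassPExcept 0).isBigO_sub_partialSum_pow 3
  have hG : L.G 3 = 0 := L.G_eq_zero_of_odd 3 (by decide)
  simp only [FormalMultilinearSeries.partialSum, Finset.sum_range_succ, zero_add,
    FormalMultilinearSeries.ofScalars_apply_eq, sumInvPow_zero] at h
  refine isBigO_norm_right.1 (h.congr (fun z ↦ ?_) fun z ↦ (norm_pow z 3).symm)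
  simp [g₂, hG, show (2 : ℂ) + 1 = 3 by norm_num]
  left
  ring

lemma isBigO_weierstrassPExcept_zero_unique {a b : ℂ}
    (h : (fun z ↦ ℘[L - (0 : ℂ)] z - a - b * z ^ 2) =O[𝓝[≠] 0] fun z ↦ z ^ 3) :
    a = 0 ∧ b = L.g₂ / 20 := by
  have hsub : (fun z ↦ a + (b - L.g₂ / 20) * z ^ 2) =O[𝓝[≠] (0 : ℂ)] fun z ↦ z ^ 3 :=
    ((L.isBigO_weierstrassPExcept_zero_sub.mono nhdsWithin_le_nhds).sub h).congr_left
      fun z ↦ by ring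
  have hlim (n : ℕ) (hn : n ≠ 0) : Tendsto (fun z : ℂ ↦ z ^ n) (𝓝[≠] 0) (𝓝 0) :=
    ((continuous_pow n).tendsto' _ _ (zero_pow hn)).mono_left nhdsWithin_le_nhds
  have ha : a = 0 := by
    refine tendsto_nhds_unique ?_ (hsub.trans_tendsto (hlim 3 three_ne_zero))
    simpa using ((hlim 2 two_ne_zero).const_mul (b - L.g₂ / 20)).const_add a
  refine ⟨ha, ?_⟩
  have hb : (fun _ ↦ b - L.g₂ / 20) =O[𝓝[≠] (0 : ℂ)] fun z ↦ z ^ 1 := by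
    refine (hsub.mul (isBigO_refl (fun z : ℂ ↦ (z ^ 2)⁻¹) _)).congr' ?_ ?_
    · filter_upwards [self_mem_nhdsWithin] with z hz
      rw [ha, zero_add, mul_inv_cancel_right₀ (pow_ne_zero 2 hz)]
    · filter_upwards [self_mem_nhdsWithin] with z hz
      rw [pow_succ' z 2, mul_inv_cancel_right₀ (pow_ne_zero 2 hz), pow_one]
  exact sub_eq_zero.1 (tendsto_nhds_unique tendsto_const_nhds
    (hb.trans_tendsto (hlim 1 one_ne_zero)))

/-- The pair of periods `ω₁, ω₂` with `ω₂ / ω₁` in the upper half plane. -/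
def ofIm {ω₁ ω₂ : ℂ} (him : 0 < (ω₂ / ω₁).im) : PeriodPair where
  ω₁ := ω₁
  ω₂ := ω₂
  indep := by
    have h1 : ω₁ ≠ 0 := by
      rintro rfl
      simp at him
    refine LinearIndependent.pair_iff.2 fun s t hst ↦ ?_
    have hdiv : (s : ℂ) + t * (ω₂ / ω₁) = 0 := by
      simp only [Complex.real_smul] at hst
      field_simp
      simpa using hst
    have ht : t = 0 := by
      have := congrArg Complex.im hdiv
      simpa [him.ne'] using this
    refine ⟨?_, ht⟩
    simpa [ht] using hdiv

lemma wp_eq_weierstrassP : wp L.ω₁ L.ω₂ = ℘[L] := by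
  ext z
  rw [← L.weierstrassP_neg z, L.weierstrassP_eq_except_zero_add, weierstrassPExcept,
    ← L.latticeEquivProd.symm.toEquiv.tsum_eq, wp, add_comm, neg_sq]
  congr 1
  refine tsum_congr fun p ↦ ?_
  have hp : ((L.latticeEquivProd.symm p : L.lattice) : ℂ) = 0 ↔ p = 0 := by simp
  refine if_congr hp.symm rfl ?_
  simp only [LinearEquiv.coe_toEquiv, latticeEquiv_symm_apply]
  congr 2
  ring

lemma half_add_half_notMem_lattice : (L.ω₁ + L.ω₂) / 2 ∉ L.lattice := by
  have := (L.mul_ω₁_add_mul_ω₂_mem_lattice (α := 1 / 2) (β := 1 / 2)).not.mpr (by norm_num)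
  convert this using 2
  push_cast
  ring

end PeriodPair

theorem stmt18 (ω₁ ω₂ : ℂ) (h1 : ω₁ ≠ 0) (h2 : ω₂ ≠ 0) (him : 0 < (ω₂ / ω₁).im)
    (ν₀ ν₂ : ℂ)
    -- the Laurent expansion `℘̃(z+ω₀) = 1/z² + ν₀ + ν₂z² + O(z⁴)` at `z = 0`,
    -- defining the coefficient `b = 12ν₀² − 20ν₂` of the ODE `(℘̃')² = 4℘̃³ + a℘̃² + b℘̃`
    (hlaurent :
      (fun z : ℂ => wpTilde ω₁ ω₂ (z + (ω₁ + ω₂) / 2) - 1 / z ^ 2 - ν₀ - ν₂ * z ^ 2)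
        =O[𝓝[≠] (0 : ℂ)] fun z => z ^ 4) :
    (∀ z : ℂ,
      (∀ n m : ℤ, z ≠ (ω₁ + ω₂) / 2 + (n : ℂ) * ω₁ + (m : ℂ) * ω₂) →
      (∀ n m : ℤ, z ≠ (n : ℂ) * ω₁ + (m : ℂ) * ω₂) →
      wpTilde ω₁ ω₂ z * wpTilde ω₁ ω₂ (z - (ω₁ + ω₂) / 2)
        = wpTilde ω₁ ω₂ ((ω₁ + ω₂) / 4) ^ 2) ∧
    wpTilde ω₁ ω₂ ((ω₁ + ω₂) / 4) ^ 2 = (12 * ν₀ ^ 2 - 20 * ν₂) / 4 := by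
  obtain ⟨L, rfl, rfl⟩ : ∃ L : PeriodPair, L.ω₁ = ω₁ ∧ L.ω₂ = ω₂ :=
    ⟨.ofIm him, rfl, rfl⟩
  have hw : (L.ω₁ + L.ω₂) / 2 ∉ L.lattice := L.half_add_half_notMem_lattice
  have hw2 : (L.ω₁ + L.ω₂) / 2 + (L.ω₁ + L.ω₂) / 2 ∈ L.lattice := by
    rw [add_halves]
    exact add_mem L.ω₁_mem_lattice L.ω₂_mem_lattice
  have hquarter : L.ω₁ / 4 + L.ω₂ / 4 ∉ L.lattice ∧
      3 * (L.ω₁ / 4 + L.ω₂ / 4) ∉ L.lattice := by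
    have h₁ := (L.mul_ω₁_add_mul_ω₂_mem_lattice (α := 1 / 4) (β := 1 / 4)).not.mpr (by norm_num)
    have h₃ := (L.mul_ω₁_add_mul_ω₂_mem_lattice (α := 3 / 4) (β := 3 / 4)).not.mpr (by norm_num)
    constructor
    · convert h₁ using 2
      push_cast
      ring
    · convert h₃ using 2
      push_cast
      ring
  simp only [wpTilde, L.wp_eq_weierstrassP] at hlaurent ⊢
  set w := (L.ω₁ + L.ω₂) / 2 with hwdef
  have hC : (℘[L] ((L.ω₁ + L.ω₂) / 4 + w) - ℘[L] w) ^ 2 = 3 * ℘[L] w ^ 2 - L.g₂ / 4 := by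
    have hsymm : ℘[L] ((L.ω₁ + L.ω₂) / 4 + w) = ℘[L] ((L.ω₁ + L.ω₂) / 4) := by
      rw [← L.weierstrassP_neg ((L.ω₁ + L.ω₂) / 4),
        ← L.weierstrassP_add_coe (-((L.ω₁ + L.ω₂) / 4)) ⟨w + w, hw2⟩]
      congr 1
      simp only [hwdef]
      ring
    rw [← L.weierstrassP_sub_mul_weierstrassP_sub hw hw2 (z := (L.ω₁ + L.ω₂) / 4)
      (by convert hquarter.1 using 2; ring)
      (by convert hquarter.2 using 2; simp only [hwdef]; ring), hsymm, sq]
  rw [hC]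
  refine ⟨fun z hz hz' ↦ ?_, ?_⟩
  · rw [sub_add_cancel]
    refine L.weierstrassP_sub_mul_weierstrassP_sub hw hw2 (fun h ↦ ?_) fun h ↦ ?_
    · obtain ⟨n, m, h⟩ := PeriodPair.mem_lattice.1 h
      exact hz' n m h.symm
    · obtain ⟨n, m, h⟩ := PeriodPair.mem_lattice.1 h
      refine hz (n - 1) (m - 1) ?_
      push_cast
      linear_combination -h + 2 * hwdef
  · have hperiod (z : ℂ) : ℘[L] (z + w + w) = ℘[L - (0 : ℂ)] z + 1 / z ^ 2 := by
      rw [add_assoc, ← L.weierstrassP_eq_except_zero_add]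
      exact L.weierstrassP_add_coe z ⟨w + w, hw2⟩
    have hpow : (fun z : ℂ ↦ z ^ 4) =O[𝓝[≠] 0] fun z ↦ z ^ 3 :=
      (isLittleO_pow_pow (by norm_num)).isBigO.mono nhdsWithin_le_nhds
    obtain ⟨h₀, h₂⟩ := L.isBigO_weierstrassPExcept_zero_unique (a := ν₀ + ℘[L] w) (b := ν₂)
      ((hlaurent.trans hpow).congr_left fun z ↦ by rw [hperiod]; ring)
    rw [h₂, eq_neg_of_add_eq_zero_left h₀]
    ring
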